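/- Let n ≥ 1 be an integer and let V : ℝⁿ → ℝ be differentiable with V > 0, θ : ℝⁿ → ℝⁿ differentiable, g : ℝⁿ → (positive-definite symmetric n×n real matrices) differentiable, and let U : ℝⁿ → ℝ and A : ℝⁿ → ℝⁿ be differentiable (time-independent potentials 𝒜₀ = U, 𝒜ᵢ = Aᵢ). With G(x) the stationary metric matrix built from V(x), θ(x), g(x), H = G⁻¹, and √|det G| = V √(det g), the Lorentzian divergence σ_F = ∇_μ𝒜^μ satisfies, at every point, (1/(V√(det g))) Σ_μ ∂_μ( V√(det g) Σ_ν H^{μν} 𝒜_ν ) = (1/(V√(det g))) Σᵢ ∂ᵢ( V√(det g) Σⱼ g^{ij} (Aⱼ − U θⱼ) ), where ∂₀ of every quantity vanishes; that is, ∇_μ A^μ = V⁻¹ D_i( V (Aⁱ − U θⁱ) ). -/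

import Mathlib

open Matrix

/-- The stationary metric matrix `G` of the spacetime metric
`𝐠 = −V²(dt + θᵢdxⁱ)² + gᵢⱼdxⁱdxʲ`. -/
def statMetric (n : ℕ) (V : ℝ) (θ : Fin n → ℝ) (g : Matrix (Fin n) (Fin n) ℝ) :
    Matrix (Unit ⊕ Fin n) (Unit ⊕ Fin n) ℝ :=
  Matrix.fromBlocks
    (Matrix.of fun _ _ => -V ^ 2)
    (Matrix.of fun _ j => -V ^ 2 * θ j)
    (Matrix.of fun i _ => -V ^ 2 * θ i)
    (Matrix.of fun i j => g i j - V ^ 2 * θ i * θ j)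

/-- The spacetime partial derivative of a time-independent function: the derivative in
the time direction (`Sum.inl`) vanishes, and in the spatial direction `Sum.inr i` it is
the partial derivative `∂ᵢ` on ℝⁿ. -/
noncomputable def stD (n : ℕ) (φ : (Fin n → ℝ) → ℝ) :
    Unit ⊕ Fin n → (Fin n → ℝ) → ℝ
  | Sum.inl _ => fun _ => 0
  | Sum.inr i => fun x => fderiv ℝ φ x (Pi.single i 1)

/-- The inverse of the stationary metric matrix, in block form. -/
theorem statMetric_inv (n : ℕ) {V : ℝ} (hV : V ≠ 0) (θ : Fin n → ℝ)
    {g : Matrix (Fin n) (Fin n) ℝ} (hg : IsUnit g.det) :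
    (statMetric n V θ g)⁻¹ =
      Matrix.fromBlocks
        (Matrix.of fun _ _ => -((V ^ 2)⁻¹ - θ ⬝ᵥ g⁻¹ *ᵥ θ))
        (Matrix.of fun _ j => -(θ ᵥ* g⁻¹) j)
        (Matrix.of fun i _ => -(g⁻¹ *ᵥ θ) i)
        g⁻¹ := by
  have hdot : ∀ i, ∑ k, g i k * (g⁻¹ *ᵥ θ) k = θ i := fun i => by
    change (g *ᵥ (g⁻¹ *ᵥ θ)) i = θ i
    rw [Matrix.mulVec_mulVec, Matrix.mul_nonsing_inv g hg, Matrix.one_mulVec]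
  have hone : ∀ i j, ∑ k, g i k * g⁻¹ k j = (1 : Matrix (Fin n) (Fin n) ℝ) i j := fun i j => by
    rw [← Matrix.mul_apply, Matrix.mul_nonsing_inv g hg]
  have hquad : ∑ k, θ k * (g⁻¹ *ᵥ θ) k = θ ⬝ᵥ g⁻¹ *ᵥ θ := rfl
  have hvec : ∀ j, ∑ k, θ k * g⁻¹ k j = (θ ᵥ* g⁻¹) j := fun _ => rfl
  apply Matrix.inv_eq_right_inv
  rw [statMetric, Matrix.fromBlocks_multiply, ← Matrix.fromBlocks_one]
  congr 1 <;> ext i j <;>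
    simp only [Matrix.add_apply, Matrix.mul_apply, Matrix.of_apply, Finset.univ_unique,
      Finset.sum_singleton, mul_neg, Finset.sum_neg_distrib, sub_mul, Finset.sum_sub_distrib,
      mul_assoc, ← Finset.mul_sum, hdot, hone, hquad, hvec, Matrix.zero_apply]
  · simp only [Matrix.one_apply_eq]
    field_simp
    ring
  · ring
  · field_simp
    ring
  · ring

/-- Raising the index of `(U, A)` with the stationary metric gives spatial components
`Aⁱ − Uθⁱ`. -/
theorem sum_statMetric_inv_inr (n : ℕ) {V : ℝ} (hV : V ≠ 0) (θ : Fin n → ℝ)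
    {g : Matrix (Fin n) (Fin n) ℝ} (hg : IsUnit g.det) (a : Unit ⊕ Fin n → ℝ) (i : Fin n) :
    ∑ ν, (statMetric n V θ g)⁻¹ (Sum.inr i) ν * a ν =
      ∑ j, g⁻¹ i j * (a (Sum.inr j) - a (Sum.inl ()) * θ j) := by
  rw [statMetric_inv n hV θ hg, Fintype.sum_sum_type]
  simp only [Finset.univ_unique, Finset.sum_singleton, Matrix.fromBlocks_apply₂₁,
    Matrix.fromBlocks_apply₂₂, Matrix.of_apply, Matrix.mulVec, dotProduct, mul_sub,
    Finset.sum_sub_distrib, neg_mul, Finset.sum_mul]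
  rw [neg_add_eq_sub]
  congr 1
  exact Finset.sum_congr rfl fun j _ => by rw [mul_assoc, mul_comm (θ j)]

/-- For the stationary metric G(x) built from differentiable fields V > 0,
θ, and positive-definite symmetric g, with inverse H and √|det G| = V √(det g), and
time-independent electromagnetic potentials 𝒜₀ = U, 𝒜ᵢ = Aᵢ, the Lorentzian divergence
σ_F = ∇_μ𝒜^μ = (1/(V√det g)) Σ_μ ∂_μ(V√det g Σ_ν H^{μν}𝒜_ν) equals
V⁻¹ D_i(V(Aⁱ − Uθⁱ)) = (1/(V√det g)) Σᵢ ∂ᵢ(V√det g Σⱼ g^{ij}(Aⱼ − Uθⱼ)). -/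
theorem lorentzian_divergence (n : ℕ) (hn : 1 ≤ n)
    (V U : (Fin n → ℝ) → ℝ) (θ A : (Fin n → ℝ) → Fin n → ℝ)
    (g : (Fin n → ℝ) → Matrix (Fin n) (Fin n) ℝ)
    (hV : Differentiable ℝ V) (hVpos : ∀ x, 0 < V x)
    (hU : Differentiable ℝ U)
    (hθ : ∀ i, Differentiable ℝ fun x => θ x i)
    (hA : ∀ i, Differentiable ℝ fun x => A x i)
    (hgd : ∀ i j, Differentiable ℝ fun x => g x i j)
    (hgpd : ∀ x, (g x).PosDef) :
    let G : (Fin n → ℝ) → Matrix (Unit ⊕ Fin n) (Unit ⊕ Fin n) ℝ :=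
      fun x => statMetric n (V x) (θ x) (g x)
    let H : (Fin n → ℝ) → Matrix (Unit ⊕ Fin n) (Unit ⊕ Fin n) ℝ := fun x => (G x)⁻¹
    let 𝒜 : (Unit ⊕ Fin n) → (Fin n → ℝ) → ℝ :=
      Sum.elim (fun _ => U) fun i x => A x i
    ∀ x : Fin n → ℝ,
      (1 / (V x * Real.sqrt (g x).det)) *
          ∑ μ, stD n
            (fun y => V y * Real.sqrt (g y).det * ∑ ν, H y μ ν * 𝒜 ν y) μ x =
        (1 / (V x * Real.sqrt (g x).det)) *
          ∑ i, fderiv ℝ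
            (fun y => V y * Real.sqrt (g y).det *
              ∑ j, (g y)⁻¹ i j * (A y j - U y * θ y j)) x (Pi.single i 1) := by
  intro G H 𝒜 x
  rw [Fintype.sum_sum_type]
  simp only [stD, Finset.sum_const_zero, zero_add]
  congr 1
  refine Finset.sum_congr rfl fun i _ => ?_
  congr 2
  funext y
  congr 1
  exact sum_statMetric_inv_inr n (hVpos y).ne' (θ y) (hgpd y).det_pos.ne'.isUnit
    (fun ν => 𝒜 ν y) i
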